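/- arXiv:2603.27988 — 7 statements merged into one kernel-verified Lean document; each statement's English description precedes it below -/
import Mathlib

section
/- Let m₁ ≥ m₂ ≥ 1 be integers and let κ be a real number with κ ≥ max{(3/2)·m₂ − 1, 2}. Then for every matrix U ∈ ℝ^{m₁×m₂} with ‖U‖_F ≤ √m₂, one has ‖κ·U + U − U·Uᵀ·U‖_F ≤ κ·√m₂. -/
open Matrix

/-- Frobenius norm of a real matrix. -/
noncomputable def frobNorm {α β : Type*} [Fintype α] [Fintype β]
    (A : Matrix α β ℝ) : ℝ :=
  Real.sqrt (∑ i, ∑ j, (A i j) ^ 2)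

lemma sum_sq_eq_trace {α β : Type*} [Fintype α] [Fintype β] (A : Matrix α β ℝ) :
    ∑ i, ∑ j, (A i j) ^ 2 = (Aᵀ * A).trace := by
  rw [Finset.sum_comm]
  simp [Matrix.trace, Matrix.mul_apply, sq]

/-- Submultiplicativity of the squared Frobenius norm. -/
lemma sum_sq_mul_le {α β γ : Type*} [Fintype α] [Fintype β] [Fintype γ]
    (A : Matrix α β ℝ) (B : Matrix β γ ℝ) :
    ∑ i, ∑ k, ((A * B) i k) ^ 2 ≤ (∑ i, ∑ j, (A i j) ^ 2) * ∑ j, ∑ k, (B j k) ^ 2 := by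
  rw [Finset.sum_mul]
  refine Finset.sum_le_sum fun i _ => ?_
  rw [Finset.sum_comm (f := fun j k => (B j k) ^ 2), Finset.mul_sum]
  exact Finset.sum_le_sum fun k _ => Finset.sum_mul_sq_le_sq_mul_sq _ _ _

/-- Boundedness of the stabilized Allen--Cahn nonlinearity
`N_κ[U] = κU + U − UUᵀU` on the Frobenius ball of radius `√m₂`. -/
theorem stmt_0 (m₁ m₂ : ℕ) (hm₂ : 1 ≤ m₂) (hm : m₂ ≤ m₁)
    (κ : ℝ) (hκ : max ((3 / 2 : ℝ) * m₂ - 1) 2 ≤ κ)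
    (U : Matrix (Fin m₁) (Fin m₂) ℝ)
    (hU : frobNorm U ≤ Real.sqrt m₂) :
    frobNorm (κ • U + U - U * Uᵀ * U) ≤ κ * Real.sqrt m₂ := by
  have hκ₁ := (le_max_left _ _).trans hκ
  have hκ₂ : (2 : ℝ) ≤ κ := (le_max_right _ _).trans hκ
  have hn : (1 : ℝ) ≤ m₂ := by exact_mod_cast hm₂
  unfold frobNorm at hU ⊢
  rw [Real.sqrt_le_sqrt_iff (by positivity)] at hU
  have hmul := sum_sq_mul_le U (Uᵀ * U - 1)
  have hG₀ : 0 ≤ ∑ i, ∑ j, ((Uᵀ * U - 1 : Matrix (Fin m₂) (Fin m₂) ℝ) i j) ^ 2 := by positivity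
  have hκn : ∑ i, ∑ j, (U i j) ^ 2 ≤ 2 * κ := by linarith
  have hle := hmul.trans (mul_le_mul_of_nonneg_right hκn hG₀)
  have hG : ∑ i, ∑ j, ((Uᵀ * U - 1 : Matrix (Fin m₂) (Fin m₂) ℝ) i j) ^ 2 =
      (Uᵀ * U * (Uᵀ * U)).trace - 2 * (Uᵀ * U).trace + m₂ := by
    rw [sum_sq_eq_trace]
    simp only [transpose_sub, transpose_mul, transpose_transpose, transpose_one, mul_sub, sub_mul,
      mul_one, one_mul, trace_sub, trace_one, Fintype.card_fin]
    ring
  have hUG : ∑ i, ∑ j, ((U * (Uᵀ * U - 1) : Matrix (Fin m₁) (Fin m₂) ℝ) i j) ^ 2 =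
      (Uᵀ * U * (Uᵀ * U) * (Uᵀ * U)).trace - 2 * (Uᵀ * U * (Uᵀ * U)).trace
        + (Uᵀ * U).trace := by
    rw [sum_sq_eq_trace]
    simp only [transpose_sub, transpose_mul, transpose_transpose, Matrix.mul_sub, Matrix.sub_mul,
      Matrix.mul_one, trace_sub, Matrix.mul_assoc]
    ring
  have hN : ∑ i, ∑ j, ((κ • U + U - U * Uᵀ * U : Matrix (Fin m₁) (Fin m₂) ℝ) i j) ^ 2 =
      (κ + 1) ^ 2 * (Uᵀ * U).trace - 2 * (κ + 1) * (Uᵀ * U * (Uᵀ * U)).trace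
        + (Uᵀ * U * (Uᵀ * U) * (Uᵀ * U)).trace := by
    rw [sum_sq_eq_trace]
    simp only [transpose_sub, transpose_add, transpose_smul, transpose_mul, transpose_transpose,
      Matrix.mul_sub, Matrix.sub_mul, Matrix.mul_add, Matrix.add_mul, Matrix.mul_smul,
      Matrix.smul_mul, trace_sub, trace_add, trace_smul, smul_eq_mul, Matrix.mul_assoc]
    ring
  rw [hG, hUG] at hle
  rw [sum_sq_eq_trace] at hU
  rw [hN]
  refine Real.sqrt_le_iff.2 ⟨by positivity, ?_⟩
  rw [mul_pow, Real.sq_sqrt (by positivity)]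
  have hslope : 0 ≤ κ * (κ - 2) := mul_nonneg (by linarith) (by linarith)
  linarith [mul_le_mul_of_nonneg_left hU hslope]
end

section
/- Let m₁ ≥ m₂ ≥ 1 be integers and let κ be a real number with κ ≥ 3·m₂ + 1. Define N_κ[U] = κ·U + U − U·Uᵀ·U for U ∈ ℝ^{m₁×m₂}. Then for all U₁, U₂ ∈ ℝ^{m₁×m₂} with ‖U₁‖_F ≤ √m₂ and ‖U₂‖_F ≤ √m₂, one has ‖N_κ[U₁] − N_κ[U₂]‖_F ≤ 2κ·‖U₁ − U₂‖_F. -/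
open Matrix

/-- The stabilized Allen--Cahn nonlinearity `N_κ[U] = κU + U − UUᵀU`. -/
def Nκ {m₁ m₂ : ℕ} (κ : ℝ) (U : Matrix (Fin m₁) (Fin m₂) ℝ) :
    Matrix (Fin m₁) (Fin m₂) ℝ :=
  κ • U + U - U * Uᵀ * U

attribute [local instance] Matrix.frobeniusNormedAddCommGroup Matrix.frobeniusNormedSpace

theorem frobNorm_eq_norm {α β : Type*} [Fintype α] [Fintype β] (A : Matrix α β ℝ) :
    frobNorm A = ‖A‖ := by
  simp [frobNorm, Matrix.frobenius_norm_def, Real.sqrt_eq_rpow]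

theorem norm_mul_transpose_mul_le {α β : Type*} [Fintype α] [Fintype β]
    (A B C : Matrix α β ℝ) : ‖A * Bᵀ * C‖ ≤ ‖A‖ * ‖B‖ * ‖C‖ :=
  calc ‖A * Bᵀ * C‖ ≤ ‖A * Bᵀ‖ * ‖C‖ := Matrix.frobenius_norm_mul _ _
    _ ≤ ‖A‖ * ‖Bᵀ‖ * ‖C‖ := by gcongr; exact Matrix.frobenius_norm_mul _ _
    _ = ‖A‖ * ‖B‖ * ‖C‖ := by rw [Matrix.frobenius_norm_transpose]

/-- The cubic map `U ↦ UUᵀU` is `3r²`-Lipschitz on the Frobenius ball of radius `r`. -/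
theorem norm_cubic_sub_cubic_le {α β : Type*} [Fintype α] [Fintype β] {r : ℝ}
    {U V : Matrix α β ℝ} (hU : ‖U‖ ≤ r) (hV : ‖V‖ ≤ r) :
    ‖U * Uᵀ * U - V * Vᵀ * V‖ ≤ 3 * r ^ 2 * ‖U - V‖ := by
  have hr : 0 ≤ r := (norm_nonneg U).trans hU
  have split : U * Uᵀ * U - V * Vᵀ * V =
      (U - V) * Uᵀ * U + V * (U - V)ᵀ * U + V * Vᵀ * (U - V) := by
    simp only [Matrix.transpose_sub, Matrix.sub_mul, Matrix.mul_sub]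
    abel
  calc ‖U * Uᵀ * U - V * Vᵀ * V‖
      ≤ ‖(U - V) * Uᵀ * U‖ + ‖V * (U - V)ᵀ * U‖ + ‖V * Vᵀ * (U - V)‖ := by
        rw [split]; exact norm_add₃_le
    _ ≤ ‖U - V‖ * ‖U‖ * ‖U‖ + ‖V‖ * ‖U - V‖ * ‖U‖ + ‖V‖ * ‖V‖ * ‖U - V‖ := by
        gcongr <;> exact norm_mul_transpose_mul_le _ _ _
    _ ≤ ‖U - V‖ * r * r + r * ‖U - V‖ * r + r * r * ‖U - V‖ := by gcongr
    _ = 3 * r ^ 2 * ‖U - V‖ := by ring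

/-- Lipschitz continuity of `N_κ` on the Frobenius ball of radius `√m₂`. -/
theorem stmt_1 (m₁ m₂ : ℕ) (hm₂ : 1 ≤ m₂) (hm : m₂ ≤ m₁)
    (κ : ℝ) (hκ : 3 * (m₂ : ℝ) + 1 ≤ κ)
    (U₁ U₂ : Matrix (Fin m₁) (Fin m₂) ℝ)
    (hU₁ : frobNorm U₁ ≤ Real.sqrt m₂) (hU₂ : frobNorm U₂ ≤ Real.sqrt m₂) :
    frobNorm (Nκ κ U₁ - Nκ κ U₂) ≤ 2 * κ * frobNorm (U₁ - U₂) := by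
  simp only [frobNorm_eq_norm] at *
  have cubic := norm_cubic_sub_cubic_le hU₁ hU₂
  rw [Real.sq_sqrt (Nat.cast_nonneg m₂)] at cubic
  have hκ₀ : 0 ≤ κ + 1 := by linarith [Nat.cast_nonneg (α := ℝ) m₂]
  have split : Nκ κ U₁ - Nκ κ U₂ =
      (κ + 1) • (U₁ - U₂) - (U₁ * U₁ᵀ * U₁ - U₂ * U₂ᵀ * U₂) := by
    simp only [Nκ, add_smul, one_smul, smul_sub]
    abel
  calc ‖Nκ κ U₁ - Nκ κ U₂‖
      ≤ ‖(κ + 1) • (U₁ - U₂)‖ + ‖U₁ * U₁ᵀ * U₁ - U₂ * U₂ᵀ * U₂‖ := by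
        rw [split]; exact norm_sub_le _ _
    _ ≤ (κ + 1) * ‖U₁ - U₂‖ + 3 * m₂ * ‖U₁ - U₂‖ := by
        rw [norm_smul, Real.norm_of_nonneg hκ₀]; gcongr
    _ = (κ + (3 * m₂ + 1)) * ‖U₁ - U₂‖ := by ring
    _ ≤ 2 * κ * ‖U₁ - U₂‖ := by gcongr; linarith
end

section
/- Let m ≥ 1 be an integer and let κ be a real number with κ ≥ max{(3/2)·m − 1, 2}. Then for every symmetric positive semidefinite matrix S ∈ ℝ^{m×m} with tr(S) ≤ m, one has (κ+1)²·tr(S) − 2(κ+1)·tr(S²) + tr(S³) ≤ m·κ². -/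
open Matrix

/-- The trace of a power of a Hermitian matrix is the corresponding power sum of its
eigenvalues. -/
theorem Matrix.IsHermitian.trace_pow_eq_sum_eigenvalues_pow {𝕜 n : Type*} [RCLike 𝕜]
    [Fintype n] [DecidableEq n] {A : Matrix n n 𝕜} (hA : A.IsHermitian) (k : ℕ) :
    trace (A ^ k) = ∑ i, (hA.eigenvalues i : 𝕜) ^ k := by
  conv_lhs => rw [hA.spectral_theorem]
  rw [← map_pow, Unitary.conjStarAlgAut_apply, trace_mul_cycle, Unitary.coe_star_mul_self,
    one_mul, diagonal_pow, trace_diagonal]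
  rfl

/-- The cubic `x (κ + 1 - x)²` lies below its tangent line at `1` for `x ≤ 2κ`. -/
theorem cubic_le_tangent_at_one {κ x : ℝ} (hx : x ≤ 2 * κ) :
    (κ + 1) ^ 2 * x - 2 * (κ + 1) * x ^ 2 + x ^ 3 ≤ κ ^ 2 + κ * (κ - 2) * (x - 1) := by
  nlinarith [mul_nonneg (sq_nonneg (x - 1)) (sub_nonneg.2 hx)]

/-- The Jensen-type trace inequality for symmetric positive semidefinite
matrices `S` with `tr(S) ≤ m`:
`(κ+1)²·tr(S) − 2(κ+1)·tr(S²) + tr(S³) ≤ m·κ²`. -/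
theorem stmt_3 (m : ℕ) (hm : 1 ≤ m)
    (κ : ℝ) (hκ : max ((3 / 2 : ℝ) * m - 1) 2 ≤ κ)
    (S : Matrix (Fin m) (Fin m) ℝ) (hS : S.PosSemidef)
    (htr : trace S ≤ m) :
    (κ + 1) ^ 2 * trace S - 2 * (κ + 1) * trace (S ^ 2) + trace (S ^ 3)
      ≤ m * κ ^ 2 := by
  obtain ⟨hκm, hκ2⟩ := max_le_iff.1 hκ
  set l := hS.isHermitian.eigenvalues
  have h1 : trace S = ∑ i, l i := hS.isHermitian.trace_eq_sum_eigenvalues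
  have h2 : trace (S ^ 2) = ∑ i, l i ^ 2 := hS.isHermitian.trace_pow_eq_sum_eigenvalues_pow 2
  have h3 : trace (S ^ 3) = ∑ i, l i ^ 3 := hS.isHermitian.trace_pow_eq_sum_eigenvalues_pow 3
  have hl (i : Fin m) : l i ≤ 2 * κ := by
    have : l i ≤ ∑ j, l j :=
      Finset.single_le_sum (fun j _ => hS.eigenvalues_nonneg j) (Finset.mem_univ i)
    linarith
  calc (κ + 1) ^ 2 * trace S - 2 * (κ + 1) * trace (S ^ 2) + trace (S ^ 3)
      = ∑ i, ((κ + 1) ^ 2 * l i - 2 * (κ + 1) * l i ^ 2 + l i ^ 3) := by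
        rw [h1, h2, h3, Finset.sum_add_distrib, Finset.sum_sub_distrib, Finset.mul_sum,
          Finset.mul_sum]
    _ ≤ ∑ i, (κ ^ 2 + κ * (κ - 2) * (l i - 1)) :=
        Finset.sum_le_sum fun i _ => cubic_le_tangent_at_one (hl i)
    _ = m * κ ^ 2 + κ * (κ - 2) * (trace S - m) := by
        simp [h1, Finset.sum_add_distrib, ← Finset.mul_sum, Finset.sum_sub_distrib]
    _ ≤ m * κ ^ 2 := by
        have : 0 ≤ κ * (κ - 2) := mul_nonneg (by linarith) (by linarith)
        linarith [mul_nonneg this (sub_nonneg.2 htr)]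
end

section
/- Let m₁ ≥ m₂ ≥ 1 be integers and let κ be a real number with κ ≥ 3·m₂ + 1. Define f(U) = U − U·Uᵀ·U and F(U) = (1/4)·(UᵀU − I)² for U ∈ ℝ^{m₁×m₂}, where I is the m₂×m₂ identity matrix. Then for all U, V ∈ ℝ^{m₁×m₂} with ‖U‖_F ≤ √m₂ and ‖V‖_F ≤ √m₂, one has tr(F(U)) − tr(F(V)) + ⟨U − V, f(V)⟩_F ≤ (κ/2)·‖U − V‖_F². -/
open Matrix

/-- Frobenius inner product `⟨A, B⟩_F = tr(AᵀB)`. -/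
def frobInner {α β : Type*} [Fintype α] [Fintype β]
    (A B : Matrix α β ℝ) : ℝ :=
  trace (Aᵀ * B)

/-- The Allen--Cahn nonlinearity `f(U) = U − UUᵀU`. -/
def fAC {m₁ m₂ : ℕ} (U : Matrix (Fin m₁) (Fin m₂) ℝ) :
    Matrix (Fin m₁) (Fin m₂) ℝ :=
  U - U * Uᵀ * U

/-- The matrix-valued Allen--Cahn potential `F(U) = (1/4)(UᵀU − I)²`. -/
noncomputable def FAC {m₁ m₂ : ℕ} (U : Matrix (Fin m₁) (Fin m₂) ℝ) :
    Matrix (Fin m₂) (Fin m₂) ℝ :=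
  (1 / 4 : ℝ) • (Uᵀ * U - 1) ^ 2

lemma frobNorm_sq {α β : Type*} [Fintype α] [Fintype β] (A : Matrix α β ℝ) :
    frobNorm A ^ 2 = ∑ i, ∑ j, (A i j) ^ 2 :=
  Real.sq_sqrt (by positivity)

lemma trace_transpose_mul_self {α β : Type*} [Fintype α] [Fintype β] (A : Matrix α β ℝ) :
    trace (Aᵀ * A) = frobNorm A ^ 2 := by
  rw [frobNorm_sq, Finset.sum_comm]
  simp [trace, Matrix.mul_apply, sq]

lemma frobNorm_transpose {α β : Type*} [Fintype α] [Fintype β] (A : Matrix α β ℝ) :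
    frobNorm Aᵀ = frobNorm A := by
  unfold frobNorm
  rw [Finset.sum_comm]
  rfl

lemma frobNorm_mul_sq_le {α β γ : Type*} [Fintype α] [Fintype β] [Fintype γ]
    (A : Matrix α β ℝ) (B : Matrix β γ ℝ) :
    frobNorm (A * B) ^ 2 ≤ frobNorm A ^ 2 * frobNorm B ^ 2 := by
  rw [frobNorm_sq, frobNorm_sq, frobNorm_sq B, Finset.sum_comm (f := fun i j => B i j ^ 2),
    Finset.sum_mul_sum]
  refine Finset.sum_le_sum fun i _ => Finset.sum_le_sum fun k _ => ?_
  rw [Matrix.mul_apply]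
  exact Finset.sum_mul_sq_le_sq_mul_sq _ _ _

lemma frobNorm_add_sq_le {α β : Type*} [Fintype α] [Fintype β] (A B : Matrix α β ℝ) :
    frobNorm (A + B) ^ 2 ≤ 2 * frobNorm A ^ 2 + 2 * frobNorm B ^ 2 := by
  simp only [frobNorm_sq, Finset.mul_sum, ← Finset.sum_add_distrib]
  refine Finset.sum_le_sum fun i _ => Finset.sum_le_sum fun j _ => ?_
  rw [Matrix.add_apply]
  nlinarith [sq_nonneg (A i j - B i j)]

/-- Exact second-order expansion of the potential `tr F` around `V`. -/
lemma trace_FAC_sub_add_frobInner {m₁ m₂ : ℕ} (U V : Matrix (Fin m₁) (Fin m₂) ℝ) :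
    trace (FAC U) - trace (FAC V) + frobInner (U - V) (fAC V) =
      1 / 4 * frobNorm (Uᵀ * (U - V) + (U - V)ᵀ * V) ^ 2
        + 1 / 2 * frobNorm ((U - V) * Vᵀ) ^ 2 - 1 / 2 * frobNorm (U - V) ^ 2 := by
  have hC : trace (Vᵀ * U) = trace (Uᵀ * V) := by
    rw [← trace_transpose]; simp
  have hPA : trace (Vᵀ * V * (Uᵀ * U)) = trace (Uᵀ * U * (Vᵀ * V)) := trace_mul_comm _ _
  have hAC : trace (Vᵀ * V * (Uᵀ * V)) = trace (Uᵀ * V * (Vᵀ * V)) := trace_mul_comm _ _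
  have hACt : trace (Vᵀ * V * (Vᵀ * U)) = trace (Uᵀ * V * (Vᵀ * V)) := by
    rw [← trace_transpose]; simp [Matrix.mul_assoc]
  have hsum : Uᵀ * (U - V) + (U - V)ᵀ * V = Uᵀ * U - Vᵀ * V := by
    rw [transpose_sub, Matrix.mul_sub, Matrix.sub_mul]; abel
  have hW : frobNorm ((U - V) * Vᵀ) ^ 2 = trace (Vᵀ * V * ((U - V)ᵀ * (U - V))) := by
    rw [← trace_transpose_mul_self, transpose_mul, transpose_transpose, Matrix.mul_assoc,
      trace_mul_comm, ← Matrix.mul_assoc (U - V)ᵀ, Matrix.mul_assoc, trace_mul_comm]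
  have hS : (Uᵀ * U - Vᵀ * V)ᵀ = Uᵀ * U - Vᵀ * V := by simp
  have hV3 : (U - V)ᵀ * (V - V * Vᵀ * V)
      = Uᵀ * V - Uᵀ * V * (Vᵀ * V) - Vᵀ * V + Vᵀ * V * (Vᵀ * V) := by
    simp only [transpose_sub, Matrix.sub_mul, Matrix.mul_sub, Matrix.mul_assoc]; abel
  have hWW : (U - V)ᵀ * (U - V) = Uᵀ * U - Uᵀ * V - Vᵀ * U + Vᵀ * V := by
    simp only [transpose_sub, Matrix.sub_mul, Matrix.mul_sub]; abel
  rw [hsum, hW, ← trace_transpose_mul_self, ← trace_transpose_mul_self (U - V), hS, hWW]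
  unfold frobInner fAC FAC
  rw [hV3]
  simp only [sq, sub_mul, mul_sub, mul_add, mul_one, one_mul, trace_smul, trace_add, trace_sub,
    smul_eq_mul]
  linarith

/-- Pointwise convexity-splitting inequality:
`tr(F(U)) − tr(F(V)) + ⟨U − V, f(V)⟩_F ≤ (κ/2)·‖U − V‖_F²`. -/
theorem stmt_6 (m₁ m₂ : ℕ) (hm₂ : 1 ≤ m₂) (hm : m₂ ≤ m₁)
    (κ : ℝ) (hκ : 3 * (m₂ : ℝ) + 1 ≤ κ)
    (U V : Matrix (Fin m₁) (Fin m₂) ℝ)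
    (hU : frobNorm U ≤ Real.sqrt m₂) (hV : frobNorm V ≤ Real.sqrt m₂) :
    trace (FAC U) - trace (FAC V) + frobInner (U - V) (fAC V)
      ≤ κ / 2 * frobNorm (U - V) ^ 2 := by
  have sq_le {A : Matrix (Fin m₁) (Fin m₂) ℝ} (hA : frobNorm A ≤ Real.sqrt m₂) :
      frobNorm A ^ 2 ≤ m₂ := by
    rw [← Real.sq_sqrt (Nat.cast_nonneg m₂)]
    exact pow_le_pow_left₀ (Real.sqrt_nonneg _) hA 2
  rw [trace_FAC_sub_add_frobInner]
  have h₁ := frobNorm_add_sq_le (Uᵀ * (U - V)) ((U - V)ᵀ * V)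
  have h₂ := frobNorm_mul_sq_le Uᵀ (U - V)
  have h₃ := frobNorm_mul_sq_le (U - V)ᵀ V
  have h₄ := frobNorm_mul_sq_le (U - V) Vᵀ
  rw [frobNorm_transpose] at h₂ h₃ h₄
  have hW := sq_nonneg (frobNorm (U - V))
  have hUW := mul_le_mul_of_nonneg_right (sq_le hU) hW
  have hVW := mul_le_mul_of_nonneg_right (sq_le hV) hW
  have hκW := mul_le_mul_of_nonneg_right hκ hW
  linarith
end

section
/- Let k ≥ 1 be an integer, let z < 0 be a real number, and let λ ∈ (0, 1]. Define φ_k(w) = (e^w − Σ_{j=0}^{k-1} w^j/j!) / w^k for w ≠ 0. Then λ^k · φ_k(λz) ≤ φ_k(z). -/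
theorem hasDerivAt_exp_sub_sum_pow_div_factorial (n : ℕ) (x : ℝ) :
    HasDerivAt (fun w : ℝ => Real.exp w - ∑ j ∈ Finset.range (n + 1), w ^ j / (Nat.factorial j))
      (Real.exp x - ∑ j ∈ Finset.range n, x ^ j / (Nat.factorial j)) x := by
  simp only [Finset.sum_range_succ']
  refine (Real.hasDerivAt_exp x).sub ?_
  have h : HasDerivAt
      (fun w : ℝ => ∑ j ∈ Finset.range n, w ^ (j + 1) / (Nat.factorial (j + 1)))
      (∑ j ∈ Finset.range n, x ^ j / (Nat.factorial j)) x := by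
    refine HasDerivAt.fun_sum fun j _ => ?_
    refine ((hasDerivAt_pow (j + 1) x).div_const (Nat.factorial (j + 1) : ℝ)).congr_deriv ?_
    rw [Nat.add_sub_cancel, Nat.factorial_succ, Nat.cast_mul,
      mul_div_mul_left _ _ (Nat.cast_ne_zero.mpr j.succ_ne_zero)]
  simpa using h.add_const 1

theorem antitoneOn_neg_one_pow_mul_of_nonneg {n : ℕ}
    (h : ∀ x : ℝ, x ≤ 0 →
      0 ≤ (-1) ^ n * (Real.exp x - ∑ j ∈ Finset.range n, x ^ j / (Nat.factorial j))) :
    AntitoneOn (fun x : ℝ => (-1) ^ (n + 1) *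
      (Real.exp x - ∑ j ∈ Finset.range (n + 1), x ^ j / (Nat.factorial j))) (Set.Iic 0) := by
  have hd (x : ℝ) :=
    (hasDerivAt_exp_sub_sum_pow_div_factorial n x).const_mul ((-1 : ℝ) ^ (n + 1))
  refine antitoneOn_of_hasDerivWithinAt_nonpos (convex_Iic 0)
    (fun x _ => (hd x).continuousAt.continuousWithinAt)
    (fun x _ => (hd x).hasDerivWithinAt) fun x hx => ?_
  have := h x (interior_subset (s := Set.Iic 0) hx)
  rw [pow_succ]
  linarith

theorem neg_one_pow_mul_exp_sub_sum_nonneg (n : ℕ) {x : ℝ} (hx : x ≤ 0) :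
    0 ≤ (-1) ^ n * (Real.exp x - ∑ j ∈ Finset.range n, x ^ j / (Nat.factorial j)) := by
  induction n generalizing x with
  | zero => simpa using (Real.exp_pos x).le
  | succ n ih =>
    have := antitoneOn_neg_one_pow_mul_of_nonneg (fun y hy => ih hy) hx Set.self_mem_Iic hx
    simpa [Finset.sum_range_succ'] using this

/-- Scalar monotonicity of the exponential-integrator function: for
`k ≥ 1`, `z < 0` and `λ ∈ (0, 1]`, one has `λ^k φ_k(λz) ≤ φ_k(z)`,
where `φ_k(w) = (e^w − Σ_{j<k} w^j/j!)/w^k` for `w ≠ 0`. -/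
theorem stmt_12 (k : ℕ) (hk : 1 ≤ k) (z : ℝ) (hz : z < 0)
    (lam : ℝ) (hlam : lam ∈ Set.Ioc (0 : ℝ) 1)
    (φ : ℝ → ℝ)
    (hφ : ∀ w : ℝ, w ≠ 0 →
      φ w = (Real.exp w - ∑ j ∈ Finset.range k, w ^ j / (Nat.factorial j)) / w ^ k) :
    lam ^ k * φ (lam * z) ≤ φ z := by
  obtain ⟨hlam_pos, hlam_le⟩ := hlam
  obtain ⟨n, rfl⟩ := Nat.exists_eq_add_of_le' hk
  have hle : z ≤ lam * z := by nlinarith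
  have hneg : lam * z < 0 := mul_neg_of_pos_of_neg hlam_pos hz
  have hmono := antitoneOn_neg_one_pow_mul_of_nonneg
    (fun _ hx => neg_one_pow_mul_exp_sub_sum_nonneg n hx) hz.le hneg.le hle
  have key (a : ℝ) : a / z ^ (n + 1) = (-1) ^ (n + 1) * a / (-z) ^ (n + 1) := by
    rw [neg_pow z, mul_div_mul_left _ _ (pow_ne_zero _ (by norm_num))]
  have hpos : 0 < (-z) ^ (n + 1) := pow_pos (neg_pos.mpr hz) _
  rw [hφ _ hneg.ne, hφ z hz.ne, mul_pow lam z (n + 1), ← mul_div_assoc,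
    mul_div_mul_left _ _ (pow_ne_zero _ hlam_pos.ne'), key, key]
  exact div_le_div_of_nonneg_right hmono hpos.le
end

section
/- Let r ≥ 1 be an integer and τ > 0 a real number, and set s_i = i·τ/r for i = 0, 1, …, r. Then for every k with 0 ≤ k ≤ r and every s ∈ [0, τ], the k-th Lagrange basis polynomial for the nodes s₀, …, s_r satisfies |ℓ_{r,k}(s)| = |∏_{i=0, i≠k}^{r} (s − s_i)/(s_k − s_i)| ≤ r^r. -/
/-- Uniform bound on the Lagrange basis polynomials for the uniform nodes
`s_i = iτ/r` on `[0, τ]`: for every `0 ≤ k ≤ r` and `s ∈ [0, τ]`,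
`|∏_{i≠k} (s − s_i)/(s_k − s_i)| ≤ r^r`. -/
theorem stmt_13 (r : ℕ) (hr : 1 ≤ r) (τ : ℝ) (hτ : 0 < τ)
    (k : ℕ) (hk : k ≤ r) (s : ℝ) (hs : s ∈ Set.Icc 0 τ) :
    |∏ i ∈ (Finset.range (r + 1)).erase k,
        (s - (i : ℝ) * τ / r) / ((k : ℝ) * τ / r - (i : ℝ) * τ / r)|
      ≤ (r : ℝ) ^ r := by
  have hr0 : (0 : ℝ) < r := by exact_mod_cast hr
  have hcard : ((Finset.range (r + 1)).erase k).card = r := by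
    rw [Finset.card_erase_of_mem (Finset.mem_range.2 (by omega)), Finset.card_range,
      Nat.add_sub_cancel]
  rw [Finset.abs_prod]
  calc
    _ ≤ ∏ _i ∈ (Finset.range (r + 1)).erase k, (r : ℝ) := by
      refine Finset.prod_le_prod (fun _ _ => abs_nonneg _) fun i hi => ?_
      obtain ⟨hik, hi⟩ := Finset.mem_erase.1 hi
      have hir : (i : ℝ) ≤ r := by exact_mod_cast Nat.le_of_lt_succ (Finset.mem_range.1 hi)
      have hki : (1 : ℝ) ≤ |(k : ℝ) - i| := by
        exact_mod_cast Int.one_le_abs (sub_ne_zero.2 (Nat.cast_injective.ne hik.symm) :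
          (k : ℤ) - i ≠ 0)
      have hnode_nonneg : 0 ≤ (i : ℝ) * τ / r := by positivity
      have hnode_le : (i : ℝ) * τ / r ≤ τ := by
        rw [div_le_iff₀ hr0, mul_comm τ]
        gcongr
      have hnum : |s - (i : ℝ) * τ / r| ≤ τ :=
        abs_le.2 ⟨by linarith [hs.1], by linarith [hs.2]⟩
      have hden : |(k : ℝ) * τ / r - (i : ℝ) * τ / r| = |(k : ℝ) - i| * (τ / r) := by
        rw [← sub_div, ← sub_mul, mul_div_assoc, abs_mul, abs_of_pos (div_pos hτ hr0)]
      rw [abs_div, hden, div_le_iff₀ (by positivity)]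
      calc
        _ ≤ τ := hnum
        _ = r * (1 * (τ / r)) := by field_simp
        _ ≤ r * (|(k : ℝ) - i| * (τ / r)) := by gcongr
    _ = (r : ℝ) ^ r := by rw [Finset.prod_const, hcard]
end

section
/- Let E be a real normed vector space, let τ > 0, let P : [0, τ] → E be a continuous function, and let M > 0 be such that ‖P(0)‖ ≤ M. Define μ = sup_{s ∈ [0,τ]} ‖P(s)‖ and α = min{ M/μ, 1 } if μ > 0, and α = 1 if μ = 0. Then for every s ∈ [0, τ], ‖P(s) − α·P(s)‖ ≤ sup_{s' ∈ [0,τ]} ‖P(s') − P(0)‖. -/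
/-- Rescaling estimate: if `P : [0, τ] → E` is continuous, `‖P(0)‖ ≤ M`,
`μ = sup_{[0,τ]} ‖P‖` and `α = min{M/μ, 1}` (with `α = 1` when `μ = 0`),
then `‖P(s) − αP(s)‖ ≤ sup_{[0,τ]} ‖P − P(0)‖` for all `s ∈ [0, τ]`. -/
theorem stmt_16 {E : Type*} [NormedAddCommGroup E] [NormedSpace ℝ E]
    (τ : ℝ) (hτ : 0 < τ) (P : ℝ → E)
    (hP : ContinuousOn P (Set.Icc 0 τ))
    (M : ℝ) (hM : 0 < M) (hP0 : ‖P 0‖ ≤ M)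
    (μ : ℝ) (hμ : μ = sSup ((fun s => ‖P s‖) '' Set.Icc 0 τ))
    (α : ℝ) (hα : α = if 0 < μ then min (M / μ) 1 else 1) :
    ∀ s ∈ Set.Icc 0 τ,
      ‖P s - α • P s‖ ≤ sSup ((fun s' => ‖P s' - P 0‖) '' Set.Icc 0 τ) := by
  intro s hs
  have h0 : (0 : ℝ) ∈ Set.Icc 0 τ := ⟨le_rfl, hτ.le⟩
  have hbddP : BddAbove ((fun s => ‖P s‖) '' Set.Icc 0 τ) :=
    isCompact_Icc.bddAbove_image hP.norm
  have hbddD : BddAbove ((fun s' => ‖P s' - P 0‖) '' Set.Icc 0 τ) :=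
    isCompact_Icc.bddAbove_image (hP.sub continuousOn_const).norm
  set D := sSup ((fun s' => ‖P s' - P 0‖) '' Set.Icc 0 τ)
  have hle : ∀ t ∈ Set.Icc 0 τ, ‖P t - P 0‖ ≤ D := fun t ht =>
    le_csSup hbddD (Set.mem_image_of_mem _ ht)
  have hD0 : 0 ≤ D := (norm_nonneg _).trans (hle 0 h0)
  have hPs : ‖P s‖ ≤ μ := hμ ▸ le_csSup hbddP (Set.mem_image_of_mem _ hs)
  have hμD : μ ≤ M + D := by
    rw [hμ]
    refine csSup_le (Set.Nonempty.image _ ⟨0, h0⟩) ?_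
    rintro _ ⟨t, ht, rfl⟩
    have h1 := norm_sub_norm_le (P t) (P 0)
    have h2 := hle t ht
    dsimp only
    linarith
  by_cases hα1 : α = 1
  · simpa [hα1] using hD0
  · have hμ0 : 0 < μ := by
      by_contra h
      exact hα1 (by rw [hα, if_neg h])
    rw [if_pos hμ0] at hα
    have hlt : M / μ < 1 := by
      by_contra! h
      exact hα1 (hα.trans (min_eq_right h))
    rw [min_eq_left hlt.le] at hα
    have hnonneg : 0 ≤ 1 - α := by linarith
    calc ‖P s - α • P s‖ = ‖(1 - α) • P s‖ := by rw [sub_smul, one_smul]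
      _ = (1 - α) * ‖P s‖ := by rw [norm_smul, Real.norm_of_nonneg hnonneg]
      _ ≤ (1 - α) * μ := mul_le_mul_of_nonneg_left hPs hnonneg
      _ = μ - M := by rw [hα]; field_simp
      _ ≤ D := by linarith
end
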